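/- arXiv:1802.07394 — 2 statements merged into one kernel-verified Lean document; each statement's English description precedes it below -/
import Mathlib

section
/- Let 1 ≤ k ≤ n and let Q be an orthogonal projection in M_n(ℂ) of rank n − k + 1. Define the operator system 𝒱_Q = {A ∈ M_n(ℂ) : QAQ is a scalar multiple of Q}. Then every operator system 𝒱'' with 𝒱_Q ⊆ 𝒱'' and dim(𝒱'') = dim(𝒱_Q) + 3 has a quantum (k+1)-clique. -/
open Matrix

/-- An operator system: a subspace of matrices containing the identity and
closed under conjugate transpose. -/
def IsOperatorSystem {ι : Type*} [Fintype ι] [DecidableEq ι]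
    (V : Submodule ℂ (Matrix ι ι ℂ)) : Prop :=
  (1 : Matrix ι ι ℂ) ∈ V ∧ ∀ A ∈ V, Aᴴ ∈ V

/-- An orthogonal projection: `P = P² = P*`. -/
def IsOrthogonalProjection {ι : Type*} [Fintype ι] [DecidableEq ι]
    (P : Matrix ι ι ℂ) : Prop :=
  P * P = P ∧ Pᴴ = P

/-- The compression `PVP = {PAP : A ∈ V}`. -/
noncomputable def compress {ι : Type*} [Fintype ι] [DecidableEq ι]
    (P : Matrix ι ι ℂ) (V : Submodule ℂ (Matrix ι ι ℂ)) :
    Submodule ℂ (Matrix ι ι ℂ) :=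
  V.map ((LinearMap.mulLeft ℂ P).comp (LinearMap.mulRight ℂ P))

/-- `V` has a quantum `k`-anticlique: a rank-`k` orthogonal projection `P`
with `dim (PVP) = 1`. -/
def HasQuantumAnticlique {ι : Type*} [Fintype ι] [DecidableEq ι]
    (V : Submodule ℂ (Matrix ι ι ℂ)) (k : ℕ) : Prop :=
  ∃ P : Matrix ι ι ℂ, IsOrthogonalProjection P ∧ P.rank = k ∧
    Module.finrank ℂ (compress P V) = 1

/-- `V` has a quantum `k`-clique: a rank-`k` orthogonal projection `P`
with `dim (PVP) = k²`. -/
def HasQuantumClique {ι : Type*} [Fintype ι] [DecidableEq ι]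
    (V : Submodule ℂ (Matrix ι ι ℂ)) (k : ℕ) : Prop :=
  ∃ P : Matrix ι ι ℂ, IsOrthogonalProjection P ∧ P.rank = k ∧
    Module.finrank ℂ (compress P V) = k ^ 2

/-- The operator system `V_Q = {A : QAQ is a scalar multiple of Q}`. -/
noncomputable def VQ {n : ℕ} (Q : Matrix (Fin n) (Fin n) ℂ) :
    Submodule ℂ (Matrix (Fin n) (Fin n) ℂ) :=
  (Submodule.span ℂ {Q}).comap
    ((LinearMap.mulLeft ℂ Q).comp (LinearMap.mulRight ℂ Q))

open Topology in
/-- If a continuous family of linear maps acquires a new direction to first nonvanishing order,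
its rank increases. -/
lemma eventually_finrank_range_lt {W Y : Type*} [AddCommGroup W] [Module ℂ W]
    [NormedAddCommGroup Y] [NormedSpace ℂ Y] [FiniteDimensional ℂ Y]
    (F : ℝ → W →ₗ[ℂ] Y) (hF : ∀ w, Continuous fun t => F t w)
    (Z : ℝ → Y) (hZ : Continuous Z) (hZ0 : Z 0 ∉ LinearMap.range (F 0))
    (hmem : ∀ t, t ≠ 0 → Z t ∈ LinearMap.range (F t)) :
    ∀ᶠ t in 𝓝[≠] (0 : ℝ), Module.finrank ℂ (LinearMap.range (F 0)) <
      Module.finrank ℂ (LinearMap.range (F t)) := by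
  set m := Module.finrank ℂ (LinearMap.range (F 0))
  let b : Module.Basis (Fin m) ℂ (LinearMap.range (F 0)) := Module.finBasis _ _
  choose e he using fun i => (b i).2
  let g : ℝ → Fin (m + 1) → Y := fun t => Fin.cons (Z t) fun i => F t (e i)
  have hg : Continuous g := by
    refine continuous_pi fun i => ?_
    refine Fin.cases ?_ (fun j => ?_) i
    · simpa [g] using hZ
    · simpa [g] using hF (e j)
  have hg0 : LinearIndependent ℂ (g 0) := by
    have hb : LinearIndependent ℂ fun i => F 0 (e i) := by
      have h : (fun i => F 0 (e i)) = (LinearMap.range (F 0)).subtype ∘ b := funext he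
      rw [h]
      exact b.linearIndependent.map' _ (Submodule.ker_subtype _)
    refine linearIndependent_finCons.2 ⟨hb, fun h => hZ0 ?_⟩
    refine Submodule.span_le.2 ?_ h
    rintro _ ⟨i, rfl⟩
    exact ⟨e i, rfl⟩
  have hev := (hg.tendsto 0).eventually hg0.eventually
  filter_upwards [nhdsWithin_le_nhds hev, self_mem_nhdsWithin] with t ht ht0
  have hsub : Submodule.span ℂ (Set.range (g t)) ≤ LinearMap.range (F t) := by
    refine Submodule.span_le.2 ?_
    rintro _ ⟨i, rfl⟩
    refine Fin.cases ?_ (fun j => ?_) i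
    · simpa [g] using hmem t ht0
    · simp [g]
  have := Submodule.finrank_mono hsub
  rw [finrank_span_eq_card ht, Fintype.card_fin] at this
  omega

/-- A proper self-adjoint subspace of matrices is annihilated by a nonzero Hermitian matrix
under the trace pairing. -/
lemma exists_hermitian_annihilator {ι : Type*} [Fintype ι] [DecidableEq ι]
    (S : Submodule ℂ (Matrix ι ι ℂ)) (hS : S ≠ ⊤) (hadj : ∀ X ∈ S, Xᴴ ∈ S) :
    ∃ T : Matrix ι ι ℂ, T ≠ 0 ∧ Tᴴ = T ∧ ∀ X ∈ S, (T * X).trace = 0 := by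
  obtain ⟨f, hf0, hf⟩ := S.exists_le_ker_of_lt_top (lt_top_iff_ne_top.2 hS)
  let T₀ : Matrix ι ι ℂ := fun i j => f (Matrix.single j i 1)
  have hT₀ : ∀ X, (T₀ * X).trace = f X := by
    intro X
    conv_rhs => rw [Matrix.matrix_eq_sum_single X]
    simp only [map_sum, Matrix.trace, Matrix.diag, Matrix.mul_apply]
    rw [Finset.sum_comm]
    refine Finset.sum_congr rfl fun i _ => Finset.sum_congr rfl fun j _ => ?_
    have : Matrix.single i j (X i j) = X i j • Matrix.single i j (1 : ℂ) := by
      simp [Matrix.smul_single]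
    rw [this, map_smul, smul_eq_mul, mul_comm]
  have hne : T₀ ≠ 0 := by
    rintro h
    refine hf0 (LinearMap.ext fun X => ?_)
    rw [← hT₀, h]
    simp
  have hann : ∀ X ∈ S, (T₀ * X).trace = 0 := fun X hX => by rw [hT₀]; exact hf hX
  have hann' : ∀ X ∈ S, (T₀ᴴ * X).trace = 0 := fun X hX => by
    have h := hann _ (hadj X hX)
    have h2 := Matrix.trace_conjTranspose (T₀ * Xᴴ)
    rw [h, Matrix.conjTranspose_mul, Matrix.conjTranspose_conjTranspose, Matrix.trace_mul_comm] at h2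
    simpa using h2
  by_cases h : T₀ + T₀ᴴ = 0
  · refine ⟨Complex.I • T₀, smul_ne_zero Complex.I_ne_zero hne, ?_, fun X hX => ?_⟩
    · rw [Matrix.conjTranspose_smul, ← neg_eq_of_add_eq_zero_right h]
      simp
    · simp [hann X hX]
  · refine ⟨T₀ + T₀ᴴ, h, ?_, fun X hX => ?_⟩
    · simp [add_comm]
    · simp [add_mul, hann X hX, hann' X hX]

/-- The compression of `W` to the columns of `U`, in the form `M ↦ U* M U`. -/
noncomputable def columnCompression {ι κ : Type*} [Fintype ι] [Fintype κ]
    (W : Submodule ℂ (Matrix ι ι ℂ)) (U : Matrix ι κ ℂ) : W →ₗ[ℂ] Matrix κ κ ℂ where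
  toFun M := Uᴴ * (M : Matrix ι ι ℂ) * U
  map_add' M N := by simp [Matrix.mul_add, Matrix.add_mul]
  map_smul' c M := by simp

open scoped ComplexOrder in
lemma eq_zero_of_trace_conjTranspose_mul_self {ι κ : Type*} [Fintype ι] [Fintype κ]
    {A : Matrix ι κ ℂ} (h : (Aᴴ * A).trace = 0) : A = 0 :=
  Matrix.trace_conjTranspose_mul_self_eq_zero_iff.1 h

lemma eq_zero_of_forall_trace {ι κ : Type*} [Fintype ι] [Fintype κ]
    {A : Matrix ι κ ℂ} (h : ∀ U : Matrix ι κ ℂ, (Uᴴ * A).trace = 0) : A = 0 :=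
  eq_zero_of_trace_conjTranspose_mul_self (h A)

lemma sq_eq_trace_smul_of_det_eq_zero {R : Type*} [CommRing R] (T : Matrix (Fin 2) (Fin 2) R)
    (h : T.det = 0) : T * T = T.trace • T := by
  rw [Matrix.det_fin_two] at h
  ext i j
  fin_cases i <;> fin_cases j <;>
    simp [Matrix.mul_apply, Fin.sum_univ_two, Matrix.trace_fin_two] <;>
    first | linear_combination -h | ring

open Topology in
/-- A self-adjoint space `W` of matrices of dimension at least four compresses onto all
`2 × 2` matrices, provided it contains a projection `Q` that is nondegenerate on some pair of
vectors. The pair is found by maximizing the rank of the compression. -/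
lemma exists_surjective_columnCompression {ι : Type*} [Fintype ι] [DecidableEq ι]
    {Q : Matrix ι ι ℂ} (hQ : IsOrthogonalProjection Q)
    (W : Submodule ℂ (Matrix ι ι ℂ)) (hadj : ∀ M ∈ W, Mᴴ ∈ W) (hQW : Q ∈ W)
    (hdim : 4 ≤ Module.finrank ℂ W)
    (U₀ : Matrix ι (Fin 2) ℂ) (hU₀ : (U₀ᴴ * Q * U₀).det ≠ 0) :
    ∃ U : Matrix ι (Fin 2) ℂ, (Uᴴ * Q * U).det ≠ 0 ∧
      LinearMap.range (columnCompression W U) = ⊤ := by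
  let d : Matrix ι (Fin 2) ℂ → ℕ := fun U =>
    Module.finrank ℂ (LinearMap.range (columnCompression W U))
  have hd : ∀ U, d U ≤ 4 := fun U => by
    refine (Submodule.finrank_le _).trans ?_
    simp [Module.finrank_matrix]
  obtain ⟨U, hU, hmax⟩ : ∃ U : Matrix ι (Fin 2) ℂ, (Uᴴ * Q * U).det ≠ 0 ∧
      ∀ U' : Matrix ι (Fin 2) ℂ, (U'ᴴ * Q * U').det ≠ 0 → d U' ≤ d U := by
    let s : Set ℕ := d '' {U | (Uᴴ * Q * U).det ≠ 0}
    have hb : BddAbove s := ⟨4, by rintro _ ⟨U, -, rfl⟩; exact hd U⟩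
    obtain ⟨U, hU, h⟩ := Nat.sSup_mem (s := s) ⟨_, U₀, hU₀, rfl⟩ hb
    exact ⟨U, hU, fun U' hU' => h ▸ le_csSup hb ⟨U', hU', rfl⟩⟩
  refine ⟨U, hU, ?_⟩
  by_contra hS
  set S := LinearMap.range (columnCompression W U) with hSdef
  have hlt : d U < 4 := by
    have := Submodule.finrank_lt hS
    simpa [Module.finrank_matrix] using this
  let _ : NormedAddCommGroup (Matrix (Fin 2) (Fin 2) ℂ) := Matrix.normedAddCommGroup
  let _ : NormedSpace ℂ (Matrix (Fin 2) (Fin 2) ℂ) := Matrix.normedSpace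
  have hpert : ∀ (U' : Matrix ι (Fin 2) ℂ) (Z : ℝ → Matrix (Fin 2) (Fin 2) ℂ), Continuous Z →
      (∀ t : ℝ, t ≠ 0 → Z t ∈ LinearMap.range (columnCompression W (U + (t : ℂ) • U'))) →
      Z 0 ∈ S := by
    intro U' Z hZ hmem
    by_contra h0
    have hUt : Continuous fun t : ℝ => U + (t : ℂ) • U' := by fun_prop
    have h1 := eventually_finrank_range_lt
      (fun t : ℝ => columnCompression W (U + (t : ℂ) • U')) (fun w => by
        change Continuous fun t : ℝ => (U + (t : ℂ) • U')ᴴ * (w : Matrix ι ι ℂ) * (U + (t : ℂ) • U')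
        exact (hUt.matrix_conjTranspose.matrix_mul continuous_const).matrix_mul hUt) Z hZ
      (by simpa [hSdef] using h0) hmem
    have hdet : Continuous fun t : ℝ =>
        ((U + (t : ℂ) • U')ᴴ * Q * (U + (t : ℂ) • U')).det :=
      ((hUt.matrix_conjTranspose.matrix_mul continuous_const).matrix_mul hUt).matrix_det
    have h2 : ∀ᶠ t : ℝ in 𝓝[≠] 0, ((U + (t : ℂ) • U')ᴴ * Q * (U + (t : ℂ) • U')).det ≠ 0 :=
      nhdsWithin_le_nhds (hdet.continuousAt.eventually_ne (by simpa using hU))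
    obtain ⟨t, ht1, ht2⟩ := (h1.and h2).exists
    have := hmax _ ht2
    have h0U : U + ((0 : ℝ) : ℂ) • U' = U := by simp
    rw [h0U] at ht1
    exact absurd ht1 (not_lt.2 this)
  have hfirst : ∀ N ∈ W, Uᴴ * N * U = 0 → ∀ U' : Matrix ι (Fin 2) ℂ,
      U'ᴴ * N * U + Uᴴ * N * U' ∈ S := by
    intro N hN h0 U'
    have := hpert U' (fun t : ℝ => (U'ᴴ * N * U + Uᴴ * N * U') + (t : ℂ) • (U'ᴴ * N * U'))
      (by fun_prop) (fun t ht => ⟨(t : ℂ)⁻¹ • ⟨N, hN⟩, ?_⟩)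
    · simpa using this
    · have ht' : (t : ℂ) ≠ 0 := by exact_mod_cast ht
      rw [map_smul, inv_smul_eq_iff₀ ht']
      simp only [columnCompression, LinearMap.coe_mk, AddHom.coe_mk, conjTranspose_add,
        conjTranspose_smul, Matrix.add_mul, Matrix.mul_add, h0, Matrix.smul_mul, Matrix.mul_smul,
        Complex.star_def, Complex.conj_ofReal, smul_add, smul_smul]
      abel
  have hsecond : ∀ N ∈ W, N * U = 0 → Uᴴ * N = 0 → ∀ U' : Matrix ι (Fin 2) ℂ,
      U'ᴴ * N * U' ∈ S := by
    intro N hN h0 h0' U'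
    refine hpert U' (fun _ => U'ᴴ * N * U') continuous_const
      (fun t ht => ⟨((t : ℂ) * t)⁻¹ • ⟨N, hN⟩, ?_⟩)
    have ht' : (t : ℂ) * t ≠ 0 := by
      have : (t : ℂ) ≠ 0 := by exact_mod_cast ht
      exact mul_ne_zero this this
    rw [map_smul, inv_smul_eq_iff₀ ht']
    have h0U' : U'ᴴ * N * U = 0 := by rw [Matrix.mul_assoc, h0, Matrix.mul_zero]
    simp [columnCompression, Matrix.add_mul, Matrix.mul_add, h0U', h0', smul_smul]
    rw [← Complex.ofReal_mul, Complex.coe_smul]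
  obtain ⟨T, hT0, hTh, hT⟩ := exists_hermitian_annihilator S hS (by
    rintro _ ⟨M, rfl⟩
    refine ⟨⟨_, hadj M M.2⟩, ?_⟩
    simp [columnCompression, Matrix.mul_assoc])
  have hTdet : T.det ≠ 0 := by
    intro hdet
    have hTQ : (T * (Uᴴ * Q * U)).trace = 0 := hT _ ⟨⟨Q, hQW⟩, rfl⟩
    have h1 : ((Q * U * T)ᴴ * (Q * U * T)).trace = 0 := by
      have : (Q * U * T)ᴴ * (Q * U * T) = T * ((Uᴴ * Q * U) * T) := by
        simp only [conjTranspose_mul, hTh, hQ.2, Matrix.mul_assoc]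
        rw [← Matrix.mul_assoc Q Q, hQ.1]
      rw [this, ← Matrix.mul_assoc, Matrix.trace_mul_comm, ← Matrix.mul_assoc,
        sq_eq_trace_smul_of_det_eq_zero T hdet, Matrix.smul_mul, Matrix.trace_smul, hTQ, smul_zero]
    have h2 := eq_zero_of_trace_conjTranspose_mul_self h1
    have h3 : (Uᴴ * Q * U) * T = 0 := by
      rw [show (Uᴴ * Q * U) * T = Uᴴ * (Q * U * T) by simp only [Matrix.mul_assoc], h2,
        Matrix.mul_zero]
    have hu : IsUnit (Uᴴ * Q * U) := (Matrix.isUnit_iff_isUnit_det _).2 hU.isUnit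
    exact hT0 (hu.mul_right_eq_zero.1 h3)
  have hTu : IsUnit T := (Matrix.isUnit_iff_isUnit_det _).2 hTdet.isUnit
  obtain ⟨Ti, hTi⟩ := hTu.exists_right_inv
  have hcancel : ∀ A : Matrix ι (Fin 2) ℂ, A * T = 0 → A = 0 := fun A hA => by
    rw [← Matrix.mul_one A, ← hTi, ← Matrix.mul_assoc, hA, Matrix.zero_mul]
  have hkill : ∀ N ∈ W, Uᴴ * N * U = 0 → N * U = 0 := by
    intro N hN h0
    refine hcancel _ (eq_zero_of_forall_trace fun U' => ?_)
    have h1 := hT _ (hfirst N hN h0 U')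
    have h2 := hT _ (hfirst N hN h0 (Complex.I • U'))
    simp only [conjTranspose_smul, Matrix.smul_mul, Matrix.mul_smul, Matrix.mul_add,
      Matrix.trace_add, Matrix.trace_smul, Complex.star_def, Complex.conj_I, smul_eq_mul] at h1 h2
    rw [← Matrix.mul_assoc, Matrix.trace_mul_comm, ← Matrix.mul_assoc U'ᴴ]
    linear_combination (1 / 2 : ℂ) * h1 + (Complex.I / 2) * h2 +
      (1 / 2 : ℂ) * ((T * (U'ᴴ * N * U)).trace - (T * (Uᴴ * N * U')).trace) * Complex.I_sq
  obtain ⟨⟨N, hN⟩, hNker, hN0⟩ : ∃ N ∈ LinearMap.ker (columnCompression W U), N ≠ 0 := by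
    refine (Submodule.ne_bot_iff _).1 fun h => ?_
    have := LinearMap.finrank_range_add_finrank_ker (columnCompression W U)
    rw [h, finrank_bot] at this
    have : d U = Module.finrank ℂ W := this
    omega
  have hNU : Uᴴ * N * U = 0 := hNker
  have h0 := hkill N hN hNU
  have h0' : Uᴴ * N = 0 := by
    have := hkill Nᴴ (hadj N hN) (by simpa [Matrix.mul_assoc] using congrArg conjTranspose hNU)
    simpa using congrArg conjTranspose this
  have hquad := fun U' => hT _ (hsecond N hN h0 h0' U')
  have hall : ∀ U' : Matrix ι (Fin 2) ℂ, N * U' = 0 := by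
    intro V
    refine hcancel _ (eq_zero_of_forall_trace fun U' => ?_)
    have h1 := hquad (U' + V)
    have h2 := hquad (U' + Complex.I • V)
    have h3 := hquad U'
    have h4 := hquad V
    simp only [conjTranspose_add, conjTranspose_smul, Matrix.smul_mul, Matrix.mul_smul,
      Matrix.mul_add, Matrix.add_mul, Matrix.trace_add, Matrix.trace_smul, Complex.star_def,
      Complex.conj_I, smul_eq_mul, h3, h4] at h1 h2
    rw [← Matrix.mul_assoc, Matrix.trace_mul_comm, ← Matrix.mul_assoc U'ᴴ]
    linear_combination (1 / 2 : ℂ) * h1 - (Complex.I / 2) * h2 +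
      (1 / 2 : ℂ) * ((T * (U'ᴴ * N * V)).trace - (T * (Vᴴ * N * U')).trace) * Complex.I_sq
  refine hN0 (Subtype.ext ?_)
  ext i j
  have := congrFun (congrFun (hall (Matrix.single j 0 1)) i) 0
  simpa using this

/-- An orthogonal projection of rank `r` factors through an isometry from `ℂ^r`. -/
lemma IsOrthogonalProjection.exists_isometry {ι : Type*} [Fintype ι] [DecidableEq ι]
    {P : Matrix ι ι ℂ} (hP : IsOrthogonalProjection P) {r : ℕ} (hr : P.rank = r) :
    ∃ J : Matrix ι (Fin r) ℂ, Jᴴ * J = 1 ∧ J * Jᴴ = P := by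
  subst hr
  let p : Submodule ℂ (EuclideanSpace ℂ ι) := LinearMap.range (Matrix.toEuclideanLin P)
  have hp : Module.finrank ℂ p = P.rank := by
    rw [Matrix.rank_eq_finrank_range_toLin P (EuclideanSpace.basisFun ι ℂ).toBasis
      (EuclideanSpace.basisFun ι ℂ).toBasis, ← Matrix.toEuclideanLin_eq_toLin_orthonormal]
  let b : OrthonormalBasis (Fin P.rank) ℂ p :=
    (stdOrthonormalBasis ℂ p).reindex (finCongr hp)
  let J : Matrix ι (Fin P.rank) ℂ := Matrix.of fun i j => (b j : EuclideanSpace ℂ ι) i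
  have hJ : Jᴴ * J = 1 := by
    ext i j
    have h := orthonormal_iff_ite.1 b.orthonormal i j
    rw [Submodule.coe_inner, PiLp.inner_apply] at h
    simp only [RCLike.inner_apply'] at h
    simpa [J, Matrix.mul_apply, Matrix.one_apply] using h
  have hPJ : P * J = J := by
    ext i j
    obtain ⟨x, hx⟩ := (b j).2
    have h : P *ᵥ (b j : EuclideanSpace ℂ ι).ofLp = (b j : EuclideanSpace ℂ ι).ofLp := by
      rw [← hx]
      simp [Matrix.toEuclideanLin, hP.1]
    exact congrFun h i
  have hJP : J * Jᴴ * P = P := by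
    ext i j
    let y : p := ⟨Matrix.toEuclideanLin P (EuclideanSpace.single j 1), _, rfl⟩
    have hy : ∀ l, (y : EuclideanSpace ℂ ι) l = P l j := fun l => by
      simp [y, Matrix.toEuclideanLin]
    have h := congrArg (fun z : p => (z : EuclideanSpace ℂ ι) i) (b.sum_repr' y)
    simp only [Submodule.coe_sum, Submodule.coe_smul, Submodule.coe_inner, PiLp.inner_apply,
      RCLike.inner_apply', hy] at h
    rw [← h, Matrix.mul_assoc]
    simp [Matrix.mul_apply, J, mul_comm]
  refine ⟨J, hJ, ?_⟩
  have h := congrArg conjTranspose hJP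
  rw [conjTranspose_mul, conjTranspose_mul, conjTranspose_conjTranspose, hP.2, ← Matrix.mul_assoc,
    hPJ] at h
  exact h

lemma IsOrthogonalProjection.trace_eq_rank {ι : Type*} [Fintype ι] [DecidableEq ι]
    {P : Matrix ι ι ℂ} (hP : IsOrthogonalProjection P) : P.trace = P.rank := by
  obtain ⟨J, hJ, hJP⟩ := hP.exists_isometry rfl
  conv_lhs => rw [← hJP, Matrix.trace_mul_comm, hJ]
  simp

lemma mem_compress {ι : Type*} [Fintype ι] [DecidableEq ι] {P : Matrix ι ι ℂ}
    {V : Submodule ℂ (Matrix ι ι ℂ)} {X : Matrix ι ι ℂ} :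
    X ∈ compress P V ↔ ∃ A ∈ V, P * A * P = X := by
  simp [compress, Submodule.mem_map, Matrix.mul_assoc]

lemma IsOrthogonalProjection.finrank_compress_top {ι : Type*} [Fintype ι] [DecidableEq ι]
    {P : Matrix ι ι ℂ} (hP : IsOrthogonalProjection P) :
    Module.finrank ℂ (compress P ⊤) = P.rank ^ 2 := by
  obtain ⟨r, hr⟩ : ∃ r, P.rank = r := ⟨_, rfl⟩
  obtain ⟨J, hJ, hJP⟩ := hP.exists_isometry hr
  let L := columnCompression ⊤ Jᴴ ∘ₗ (Submodule.topEquiv.symm :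
    Matrix (Fin r) (Fin r) ℂ ≃ₗ[ℂ] _).toLinearMap
  have hL : ∀ Y, L Y = J * Y * Jᴴ := fun Y => by simp [L, columnCompression]
  have hinj : Function.Injective L := by
    intro X Y h
    have h2 : Jᴴ * (J * X * Jᴴ) * J = Jᴴ * (J * Y * Jᴴ) * J := by rw [← hL, ← hL, h]
    simpa [Matrix.mul_assoc, hJ, ← Matrix.mul_assoc Jᴴ J] using h2
  have hrange : compress P ⊤ = LinearMap.range L := by
    ext X
    rw [mem_compress, LinearMap.mem_range]
    constructor
    · rintro ⟨A, -, rfl⟩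
      exact ⟨Jᴴ * A * J, by rw [hL, ← hJP]; simp only [Matrix.mul_assoc]⟩
    · rintro ⟨Y, rfl⟩
      refine ⟨J * Y * Jᴴ, trivial, ?_⟩
      rw [hL, ← hJP]
      simp only [Matrix.mul_assoc]
      simp only [← Matrix.mul_assoc Jᴴ J, hJ, Matrix.one_mul]
  rw [hrange, LinearMap.finrank_range_of_inj hinj, hr, Module.finrank_matrix]
  simp [sq]

lemma finrank_map_add_finrank_of_ker_le {K E F : Type*} [Field K] [AddCommGroup E] [Module K E]
    [FiniteDimensional K E] [AddCommGroup F] [Module K F] (f : E →ₗ[K] F) (V : Submodule K E)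
    (h : LinearMap.ker f ≤ V) :
    Module.finrank K (V.map f) + Module.finrank K (LinearMap.ker f) = Module.finrank K V := by
  rw [← LinearMap.finrank_range_add_finrank_ker (f.domRestrict V), LinearMap.range_domRestrict,
    LinearMap.ker_domRestrict, (Submodule.comapSubtypeEquivOfLe h).finrank_eq]

/-- If `Q V Q` compresses onto all matrices along the columns of `U`, then the projection onto
the sum of `(range Q)ᗮ` and the span of the columns of `Q U` is a clique. -/
lemma exists_clique_of_corner {ι : Type*} [Fintype ι] [DecidableEq ι]
    {Q : Matrix ι ι ℂ} (hQ : IsOrthogonalProjection Q) {V : Submodule ℂ (Matrix ι ι ℂ)}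
    (hker : ∀ A, Q * A * Q = 0 → A ∈ V) {l : ℕ} {U : Matrix ι (Fin l) ℂ}
    (hU : (Uᴴ * Q * U).det ≠ 0)
    (hsurj : LinearMap.range (columnCompression (compress Q V) U) = ⊤) {m : ℕ}
    (hm : m + Q.rank = Fintype.card ι + l) : HasQuantumClique V m := by
  have hG : IsUnit (Uᴴ * Q * U).det := hU.isUnit
  set G := Uᴴ * Q * U with hGdef
  have hGinv : G⁻¹ * G = 1 := Matrix.nonsing_inv_mul G hG
  have hGh : Gᴴ = G := by simp [hGdef, hQ.2, Matrix.mul_assoc]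
  set R := Q * U * G⁻¹ * Uᴴ * Q with hR
  have hRh : Rᴴ = R := by
    simp [hR, Matrix.conjTranspose_nonsing_inv, hGh, hQ.2, Matrix.mul_assoc]
  have hQR : Q * R = R := by
    simp only [hR, ← Matrix.mul_assoc, hQ.1]
  have hRQ : R * Q = R := by
    simp only [hR, Matrix.mul_assoc, hQ.1]
  have hRR : R * R = R := by
    calc R * R = Q * U * G⁻¹ * (Uᴴ * (Q * Q) * U) * G⁻¹ * Uᴴ * Q := by
          simp only [hR, Matrix.mul_assoc]
      _ = Q * U * (G⁻¹ * G) * G⁻¹ * Uᴴ * Q := by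
          rw [hQ.1, ← hGdef]; simp only [Matrix.mul_assoc]
      _ = R := by rw [hGinv, Matrix.mul_one]
  have htrR : R.trace = l := by
    calc R.trace = (G⁻¹ * (Uᴴ * (Q * Q) * U)).trace := by
          rw [show R = (Q * U) * (G⁻¹ * Uᴴ * Q) by simp only [hR, Matrix.mul_assoc],
            Matrix.trace_mul_comm]
          simp only [Matrix.mul_assoc]
      _ = l := by rw [hQ.1, ← hGdef, hGinv]; simp
  set P := 1 - Q + R with hPdef
  have hPQ : P * Q = R := by simp [hPdef, add_mul, sub_mul, hQ.1, hRQ]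
  have hQP : Q * P = R := by simp [hPdef, mul_add, mul_sub, hQ.1, hQR]
  have hPR : P * R = R := by simp [hPdef, add_mul, sub_mul, hQR, hRR]
  have hP : IsOrthogonalProjection P := by
    refine ⟨?_, by simp [hPdef, hQ.2, hRh]⟩
    calc P * P = P * (1 - Q + R) := rfl
      _ = P := by rw [mul_add, mul_sub, mul_one, hPQ, hPR, sub_add_cancel]
  have hrank : P.rank = m := by
    have h : (P.rank : ℂ) + Q.rank = Fintype.card ι + l := by
      rw [← hP.trace_eq_rank, ← hQ.trace_eq_rank, hPdef, Matrix.trace_add, Matrix.trace_sub,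
        htrR, Matrix.trace_one]
      ring
    have h' : P.rank + Q.rank = Fintype.card ι + l := by exact_mod_cast h
    omega
  refine ⟨P, hP, hrank, ?_⟩
  rw [← hrank, ← hP.finrank_compress_top]
  suffices compress P V = compress P ⊤ by rw [this]
  refine le_antisymm (Submodule.map_mono le_top) fun X hX => ?_
  obtain ⟨A, -, rfl⟩ := mem_compress.1 hX
  obtain ⟨⟨M, hM⟩, hMA⟩ : Uᴴ * (Q * A * Q) * U ∈
      LinearMap.range (columnCompression (compress Q V) U) := hsurj ▸ trivial
  obtain ⟨B, hB, rfl⟩ := mem_compress.1 hM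
  replace hMA : Uᴴ * (Q * B * Q) * U = Uᴴ * (Q * A * Q) * U := hMA
  have hRBA : R * B * R = R * A * R := by
    have h : ∀ C, R * C * R = Q * U * G⁻¹ * (Uᴴ * (Q * C * Q) * U) * G⁻¹ * Uᴴ * Q := fun C => by
      simp only [hR, Matrix.mul_assoc]
    rw [h, h, hMA]
  refine mem_compress.2 ⟨B + ((A - B) - Q * (A - B) * Q), V.add_mem hB (hker _ ?_), ?_⟩
  · have : Q * (Q * (A - B) * Q) * Q = Q * (A - B) * Q := by
      calc _ = (Q * Q) * (A - B) * (Q * Q) := by simp only [Matrix.mul_assoc]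
        _ = _ := by rw [hQ.1]
    rw [mul_sub, sub_mul, this, sub_self]
  · have : P * (Q * (A - B) * Q) * P = R * A * R - R * B * R := by
      calc _ = (P * Q) * (A - B) * (Q * P) := by simp only [Matrix.mul_assoc]
        _ = _ := by rw [hPQ, hQP, mul_sub, sub_mul]
    rw [show B + ((A - B) - Q * (A - B) * Q) = A - Q * (A - B) * Q by abel, mul_sub, sub_mul,
      this, hRBA, sub_self, sub_zero]

theorem stmt_15 (n k : ℕ) (hk : 1 ≤ k) (hkn : k ≤ n)
    (Q : Matrix (Fin n) (Fin n) ℂ)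
    (hQ : IsOrthogonalProjection Q) (hQrank : Q.rank = n - k + 1)
    (V'' : Submodule ℂ (Matrix (Fin n) (Fin n) ℂ))
    (hV'' : IsOperatorSystem V'')
    (hle : VQ Q ≤ V'')
    (hdim : Module.finrank ℂ V'' = Module.finrank ℂ (VQ Q) + 3) :
    HasQuantumClique V'' (k + 1) := by
  have hQ0 : Q ≠ 0 := by
    rintro rfl
    simp at hQrank
  have hQQQ : Q * Q * Q = Q := by rw [hQ.1, hQ.1]
  have hkerVQ : ∀ A, Q * A * Q = 0 → A ∈ VQ Q := fun A hA => by
    rw [VQ, Submodule.mem_comap]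
    simp [← Matrix.mul_assoc, hA]
  have hdimW : 4 ≤ Module.finrank ℂ (compress Q V'') := by
    have hker : LinearMap.ker ((LinearMap.mulLeft ℂ Q).comp (LinearMap.mulRight ℂ Q)) ≤ VQ Q :=
      fun A hA => hkerVQ A (by simpa [← Matrix.mul_assoc] using hA)
    have h1 := finrank_map_add_finrank_of_ker_le _ _ hker
    have h2 := finrank_map_add_finrank_of_ker_le _ _ (hker.trans hle)
    have h3 : 1 ≤ Module.finrank ℂ (compress Q (VQ Q)) := by
      refine Submodule.one_le_finrank_iff.2 ((Submodule.ne_bot_iff _).2 ⟨Q, ?_, hQ0⟩)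
      refine mem_compress.2 ⟨Q, ?_, hQQQ⟩
      rw [VQ, Submodule.mem_comap]
      simp [hQ.1, Submodule.mem_span_singleton_self]
    unfold compress at h3 ⊢
    omega
  have hr : 2 ≤ Q.rank := by
    have h : compress Q V'' ≤ compress Q ⊤ := Submodule.map_mono le_top
    have := hdimW.trans (Submodule.finrank_mono h)
    rw [hQ.finrank_compress_top] at this
    nlinarith
  obtain ⟨r, hrQ⟩ : ∃ r, Q.rank = r := ⟨_, rfl⟩
  rw [hrQ] at hr
  obtain ⟨J, hJ, hJQ⟩ := hQ.exists_isometry hrQ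
  let E : Matrix (Fin r) (Fin 2) ℂ := (1 : Matrix _ _ ℂ).submatrix id (Fin.castLE hr)
  have hE : Eᴴ * E = 1 := by
    ext i j
    simp [E, Matrix.mul_apply, Matrix.one_apply]
  have hU₀ : ((J * E)ᴴ * Q * (J * E)) = 1 := by
    calc _ = Eᴴ * (Jᴴ * Q * J) * E := by simp only [conjTranspose_mul, Matrix.mul_assoc]
      _ = Eᴴ * ((Jᴴ * J) * (Jᴴ * J)) * E := by rw [← hJQ]; simp only [Matrix.mul_assoc]
      _ = 1 := by rw [hJ, Matrix.mul_one, Matrix.mul_one, hE]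
  obtain ⟨U, hU, hsurj⟩ := exists_surjective_columnCompression hQ (compress Q V'')
    (fun M hM => by
      obtain ⟨A, hA, rfl⟩ := mem_compress.1 hM
      exact mem_compress.2 ⟨Aᴴ, hV''.2 A hA, by simp [hQ.2, Matrix.mul_assoc]⟩)
    (mem_compress.2 ⟨1, hV''.1, by rw [mul_one, hQ.1]⟩) hdimW (J * E) (by rw [hU₀]; simp)
  refine exists_clique_of_corner hQ (fun A hA => hle (hkerVQ A hA)) hU hsurj ?_
  rw [hQrank, Fintype.card_fin]
  omega
end

section
/- For all k ≥ 1 and n ≥ k + 1 there exists an operator system in M_n(ℂ) of dimension 2(k−1)n − (k−1)² + 3 having no quantum (k+1)-clique. (Equivalently, the upper quantum Turán number T↑(n,k), the largest dimension of an operator system in M_n(ℂ) having no quantum (k+1)-clique, satisfies T↑(n,k) ≥ 2(k−1)n − (k−1)² + 3.) -/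
open Matrix

/-- The span of the identity and the two off-diagonal matrix units on the first two coordinates. -/
noncomputable def offDiagonalSystem (q : ℕ) : Submodule ℂ (Matrix (Fin (q + 2)) (Fin (q + 2)) ℂ) :=
  Submodule.span ℂ (Set.range ![1, Matrix.single 0 1 1, Matrix.single 1 0 1])

theorem finrank_offDiagonalSystem (q : ℕ) : Module.finrank ℂ (offDiagonalSystem q) = 3 := by
  have h : LinearIndependent ℂ
      ![(1 : Matrix (Fin (q + 2)) (Fin (q + 2)) ℂ), Matrix.single 0 1 1, Matrix.single 1 0 1] := by
    rw [Fintype.linearIndependent_iff]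
    intro g hg
    rw [Fin.sum_univ_three] at hg
    have h00 := congrFun (congrFun hg 0) 0
    have h01 := congrFun (congrFun hg 0) 1
    have h10 := congrFun (congrFun hg 1) 0
    simp at h00 h01 h10
    intro i
    fin_cases i
    exacts [h00, h01, h10]
  rw [offDiagonalSystem, finrank_span_eq_card h, Fintype.card_fin]

theorem isOperatorSystem_offDiagonalSystem (q : ℕ) : IsOperatorSystem (offDiagonalSystem q) := by
  refine ⟨Submodule.subset_span ⟨0, rfl⟩, fun A hA => ?_⟩
  induction hA using Submodule.span_induction with
  | mem x hx =>
    obtain ⟨i, rfl⟩ := hx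
    fin_cases i
    · exact Submodule.subset_span ⟨0, by simp⟩
    · exact Submodule.subset_span ⟨2, by simp [Matrix.conjTranspose_single]⟩
    · exact Submodule.subset_span ⟨1, by simp [Matrix.conjTranspose_single]⟩
  | zero => simp
  | add x y _ _ hx hy => simpa using add_mem hx hy
  | smul a x _ hx => simpa using Submodule.smul_mem _ (star a) hx

/-- Matrices on `p + m` coordinates whose lower right `m × m` block lies in `W`. -/
noncomputable def cornerSystem (p : ℕ) {m : ℕ} (W : Submodule ℂ (Matrix (Fin m) (Fin m) ℂ)) :
    Submodule ℂ (Matrix (Fin (p + m)) (Fin (p + m)) ℂ) where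
  carrier := {A | A.submatrix (Fin.natAdd p) (Fin.natAdd p) ∈ W}
  add_mem' hA hB := add_mem (S := Submodule ℂ (Matrix (Fin m) (Fin m) ℂ)) hA hB
  zero_mem' := W.zero_mem
  smul_mem' c _ hA := W.smul_mem c hA

theorem IsOperatorSystem.cornerSystem {p m : ℕ} {W : Submodule ℂ (Matrix (Fin m) (Fin m) ℂ)}
    (hW : IsOperatorSystem W) : IsOperatorSystem (cornerSystem p W) := by
  refine ⟨?_, fun A hA => hW.2 _ hA⟩
  change (1 : Matrix _ _ ℂ).submatrix _ _ ∈ W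
  rw [Matrix.submatrix_one _ (Fin.natAdd_injective m p)]
  exact hW.1

theorem finrank_cornerSystem (p : ℕ) {m : ℕ} (W : Submodule ℂ (Matrix (Fin m) (Fin m) ℂ)) :
    Module.finrank ℂ (cornerSystem p W) + m ^ 2 = (p + m) ^ 2 + Module.finrank ℂ W := by
  let f : Matrix (Fin (p + m)) (Fin (p + m)) ℂ →ₗ[ℂ] Matrix (Fin m) (Fin m) ℂ :=
    { toFun := fun A => A.submatrix (Fin.natAdd p) (Fin.natAdd p)
      map_add' := fun _ _ => rfl
      map_smul' := fun _ _ => rfl }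
  have hf : Function.Surjective f := by
    intro B
    let B' : Matrix (Fin (p + m)) (Fin (p + m)) ℂ := Matrix.of fun i j =>
      Fin.addCases (fun _ => 0) (fun a => Fin.addCases (fun _ => 0) (fun b => B a b) j) i
    refine ⟨B', ?_⟩
    ext a b
    change B' (Fin.natAdd p a) (Fin.natAdd p b) = B a b
    simp [B']
  have hker : LinearMap.ker (W.mkQ ∘ₗ f) = cornerSystem p W := by
    ext A
    rw [LinearMap.mem_ker, LinearMap.comp_apply, Submodule.mkQ_apply, Submodule.Quotient.mk_eq_zero]
    rfl
  have hrange : LinearMap.range (W.mkQ ∘ₗ f) = ⊤ :=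
    LinearMap.range_eq_top.2 (W.mkQ_surjective.comp hf)
  have h1 := LinearMap.finrank_range_add_finrank_ker (W.mkQ ∘ₗ f)
  rw [hker, hrange, finrank_top] at h1
  have h2 := W.finrank_quotient_add_finrank
  simp only [Module.finrank_matrix, Fintype.card_fin, Module.finrank_self, mul_one] at h1 h2
  rw [sq, sq]
  omega

theorem finrank_compress_top_le {n : ℕ} (P : Matrix (Fin n) (Fin n) ℂ) :
    Module.finrank ℂ (compress P ⊤) ≤ P.rank ^ 2 := by
  let e : LinearMap.range P.mulVecLin ≃ₗ[ℂ] (Fin P.rank → ℂ) :=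
    (Module.finBasisOfFinrankEq ℂ (LinearMap.range P.mulVecLin) rfl).equivFun
  let B := LinearMap.toMatrix' ((LinearMap.range P.mulVecLin).subtype ∘ₗ e.symm.toLinearMap)
  let C := LinearMap.toMatrix' (e.toLinearMap ∘ₗ P.mulVecLin.rangeRestrict)
  have hBC : P = B * C := by
    rw [← LinearMap.toMatrix'_comp]
    refine (LinearMap.toMatrix'_toLin' P).symm.trans (congrArg _ (LinearMap.ext fun x => ?_))
    simp
  let F : Matrix (Fin P.rank) (Fin P.rank) ℂ →ₗ[ℂ] Matrix (Fin n) (Fin n) ℂ :=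
    { toFun := fun Y => B * Y * C
      map_add' := fun _ _ => by rw [Matrix.mul_add, Matrix.add_mul]
      map_smul' := fun _ _ => by simp }
  have hle : compress P ⊤ ≤ LinearMap.range F := by
    rintro _ ⟨X, -, rfl⟩
    refine ⟨C * X * B, ?_⟩
    change B * (C * X * B) * C = P * (X * P)
    calc B * (C * X * B) * C = (B * C) * (X * (B * C)) := by simp only [Matrix.mul_assoc]
      _ = P * (X * P) := by rw [← hBC]
  refine (Submodule.finrank_mono hle).trans (F.finrank_range_le.trans ?_)
  simp [Module.finrank_matrix, sq]

theorem exists_injective_mulVec_range_eq_zero {p m : ℕ} (P : Matrix (Fin (p + m)) (Fin (p + m)) ℂ)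
    {r : ℕ} (hP : p + r ≤ P.rank) :
    ∃ g : (Fin r → ℂ) →ₗ[ℂ] (Fin (p + m) → ℂ), Function.Injective g ∧
      (∀ c, g c ∈ LinearMap.range P.mulVecLin) ∧ ∀ c i, g c (Fin.castAdd m i) = 0 := by
  let T : LinearMap.range P.mulVecLin →ₗ[ℂ] (Fin p → ℂ) :=
    (LinearMap.funLeft ℂ ℂ (Fin.castAdd m)) ∘ₗ (LinearMap.range P.mulVecLin).subtype
  have hT : r ≤ Module.finrank ℂ (LinearMap.ker T) := by
    have h1 := T.finrank_range_add_finrank_ker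
    have h2 := (LinearMap.range T).finrank_le
    have h3 : Module.finrank ℂ (LinearMap.range P.mulVecLin) = P.rank := rfl
    rw [Module.finrank_fin_fun] at h2
    omega
  obtain ⟨b, hb⟩ := exists_linearIndependent_of_le_finrank hT
  let L := Fintype.linearCombination ℂ b
  have hL : Function.Injective L :=
    linearIndependent_iff_injective_fintypeLinearCombination.1 hb
  refine ⟨(LinearMap.range P.mulVecLin).subtype ∘ₗ (LinearMap.ker T).subtype ∘ₗ L,
    Subtype.val_injective.comp (Subtype.val_injective.comp hL),
    fun c => (L c).1.2, fun c i => congrFun (L c).2 i⟩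

theorem not_hasQuantumClique_cornerSystem {p m r : ℕ}
    {W : Submodule ℂ (Matrix (Fin m) (Fin m) ℂ)} (hW : Module.finrank ℂ W < r ^ 2) :
    ¬ HasQuantumClique (cornerSystem p W) (p + r) := by
  rintro ⟨P, ⟨hPP, hPs⟩, hrank, hdim⟩
  obtain ⟨g, hg, hgr, hg0⟩ := exists_injective_mulVec_range_eq_zero P hrank.ge
  obtain ⟨l, hl⟩ := g.exists_leftInverse_of_injective (LinearMap.ker_eq_bot.2 hg)
  let U := LinearMap.toMatrix' g
  let L := LinearMap.toMatrix' l
  have hLU : L * U = 1 := by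
    rw [← LinearMap.toMatrix'_comp, hl, LinearMap.toMatrix'_id]
  have hPU : P * U = U := by
    rw [← LinearMap.toMatrix'_toLin' P, ← LinearMap.toMatrix'_comp]
    refine congrArg _ (LinearMap.ext fun c => ?_)
    obtain ⟨y, hy⟩ := hgr c
    rw [LinearMap.comp_apply, ← hy]
    simp [Matrix.mulVec_mulVec, hPP]
  have hUP : Uᴴ * P = Uᴴ := by
    rw [← hPs, ← Matrix.conjTranspose_mul, hPU]
  have hU0 : ∀ i j, U (Fin.castAdd m i) j = 0 := fun i j => by
    simp [U, LinearMap.toMatrix'_apply, hg0]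
  let U' := U.submatrix (Fin.natAdd p) id
  have hcorner : ∀ A : Matrix (Fin (p + m)) (Fin (p + m)) ℂ,
      Uᴴ * A * U = U'ᴴ * A.submatrix (Fin.natAdd p) (Fin.natAdd p) * U' := by
    intro A
    ext i j
    simp [Matrix.mul_apply, Fin.sum_univ_add, hU0, U']
  have htop : compress P (cornerSystem p W) = compress P ⊤ :=
    Submodule.eq_of_le_of_finrank_le (Submodule.map_mono le_top)
      ((finrank_compress_top_le P).trans (by rw [hdim, hrank]))
  let F : Matrix (Fin m) (Fin m) ℂ →ₗ[ℂ] Matrix (Fin r) (Fin r) ℂ :=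
    { toFun := fun A => U'ᴴ * A * U'
      map_add' := fun _ _ => by rw [Matrix.mul_add, Matrix.add_mul]
      map_smul' := fun _ _ => by simp }
  have hF : W.map F = ⊤ := by
    refine eq_top_iff.2 fun Y _ => ?_
    have hmem : P * ((Lᴴ * Y * L) * P) ∈ compress P (cornerSystem p W) := by
      rw [htop]
      exact ⟨_, trivial, rfl⟩
    obtain ⟨A, hA, hAP⟩ := hmem
    change P * (A * P) = _ at hAP
    have hcompr : ∀ X, Uᴴ * X * U = Uᴴ * (P * (X * P)) * U := fun X => by
      rw [← Matrix.mul_assoc, hUP, Matrix.mul_assoc, Matrix.mul_assoc, Matrix.mul_assoc, hPU]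
    refine ⟨_, hA, ?_⟩
    change U'ᴴ * A.submatrix (Fin.natAdd p) (Fin.natAdd p) * U' = Y
    rw [← hcorner, hcompr, hAP, ← hcompr]
    calc Uᴴ * (Lᴴ * Y * L) * U = (L * U)ᴴ * Y * (L * U) := by
          simp only [Matrix.conjTranspose_mul, Matrix.mul_assoc]
      _ = Y := by simp [hLU]
  have hle := Submodule.finrank_map_le F W
  rw [hF, finrank_top] at hle
  simp only [Module.finrank_matrix, Fintype.card_fin, Module.finrank_self, mul_one, ← sq] at hle
  omega

theorem stmt_16 (n k : ℕ) (hk : 1 ≤ k) (hn : k + 1 ≤ n) :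
    ∃ V : Submodule ℂ (Matrix (Fin n) (Fin n) ℂ),
      IsOperatorSystem V ∧
      Module.finrank ℂ V = 2 * (k - 1) * n - (k - 1) ^ 2 + 3 ∧
      ¬ HasQuantumClique V (k + 1) := by
  obtain ⟨p, rfl⟩ := Nat.exists_eq_add_of_le' hk
  obtain ⟨q, rfl⟩ : ∃ q, n = p + (q + 2) := ⟨n - (p + 2), by omega⟩
  refine ⟨cornerSystem p (offDiagonalSystem q),
    (isOperatorSystem_offDiagonalSystem q).cornerSystem, ?_,
    not_hasQuantumClique_cornerSystem (r := 2) (by simp [finrank_offDiagonalSystem])⟩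
  have h := finrank_cornerSystem p (offDiagonalSystem q)
  rw [finrank_offDiagonalSystem] at h
  have hsub : 2 * p * (p + (q + 2)) - p ^ 2 = p ^ 2 + 2 * p * (q + 2) := by
    rw [Nat.sub_eq_iff_eq_add (by nlinarith)]
    ring
  rw [Nat.add_sub_cancel, hsub]
  linarith
end
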